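/- Every nonnegative integer n can be written as n = p₃(w) + p₆(x) + 2·p₆(y) + 2·p₆(z) with w, x, y, z nonnegative integers. -/

import Mathlib

/-- Bit set (as a natural number) of all `f i + s` with `i < k` and `s` in the bit set `S`. -/
def sumMask (f : ℕ → ℕ) (S : ℕ) : ℕ → ℕ
  | 0 => 0
  | k + 1 => Nat.lor (sumMask f S k) (Nat.shiftLeft S (f k))

theorem sumMask_sound (f : ℕ → ℕ) (S n : ℕ) : ∀ k, (sumMask f S k).testBit n = true →
    ∃ i, f i ≤ n ∧ S.testBit (n - f i) = true := by
  intro k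
  induction k with
  | zero => simp [sumMask]
  | succ k ih =>
    intro h
    have h' : ((sumMask f S k) ||| (S <<< f k)).testBit n = true := h
    rw [Nat.testBit_or, Nat.testBit_shiftLeft] at h'
    simp only [Bool.or_eq_true, Bool.and_eq_true, decide_eq_true_eq] at h'
    rcases h' with h' | ⟨h1, h2⟩
    · exact ih h'
    · exact ⟨k, h1, h2⟩

def fullMask : ℕ :=
  sumMask (fun w => w * (w + 1) / 2) (sumMask (fun x => x * (2 * x - 1))
    (sumMask (fun y => 2 * (y * (2 * y - 1))) (sumMask (fun z => 2 * (z * (2 * z - 1))) 1 26) 26) 37) 72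

theorem fullMask_mod : fullMask % 2 ^ 2600 = 2 ^ 2600 - 1 := by
  decide +kernel

theorem testBit_of_mod (F N n : ℕ) (hF : F % 2 ^ N = 2 ^ N - 1) (hn : n < N) :
    F.testBit n = true := by
  have h : (F % 2 ^ N).testBit n = true := by
    rw [hF, Nat.testBit_two_pow_sub_one]
    simpa using hn
  rw [Nat.testBit_mod_two_pow] at h
  simp only [Bool.and_eq_true] at h
  exact h.2

theorem small_case (n : ℕ) (hn : n < 2600) : ∃ w x y z : ℕ,
      n = w * (w + 1) / 2 + x * (2 * x - 1)
          + 2 * (y * (2 * y - 1)) + 2 * (z * (2 * z - 1)) := by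
  have h := testBit_of_mod fullMask 2600 n fullMask_mod hn
  obtain ⟨w, hw, h⟩ := sumMask_sound _ _ _ _ h
  obtain ⟨x, hx, h⟩ := sumMask_sound _ _ _ _ h
  obtain ⟨y, hy, h⟩ := sumMask_sound _ _ _ _ h
  obtain ⟨z, hz, h⟩ := sumMask_sound _ _ _ _ h
  have h0 := Nat.testBit_one_eq_true_iff_self_eq_zero.1 h
  refine ⟨w, x, y, z, ?_⟩
  omega

/-- Integer with prescribed residue: nearest-integer shift. -/
theorem exists_shift (a f : ℤ) (ha : 0 < a) : ∃ k : ℤ, 2 * (f + k * a) ≤ a ∧ -a ≤ 2 * (f + k * a) := by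
  refine ⟨-((2 * f + a) / (2 * a)), ?_⟩
  have h1 := Int.emod_add_mul_ediv (2 * f + a) (2 * a)
  have h2 := Int.emod_nonneg (2 * f + a) (show (2 * a) ≠ 0 by omega)
  have h3 := Int.emod_lt_of_pos (2 * f + a) (show 0 < 2 * a by omega)
  constructor <;> nlinarith

/-- A ternary Gram matrix realised by integer vectors. -/
def IsGram (a b c d e f : ℤ) : Prop :=
  ∃ p₁ q₁ r₁ p₂ q₂ r₂ p₃ q₃ r₃ : ℤ,
    a = p₁ ^ 2 + q₁ ^ 2 + r₁ ^ 2 ∧ b = p₂ ^ 2 + q₂ ^ 2 + r₂ ^ 2 ∧ c = p₃ ^ 2 + q₃ ^ 2 + r₃ ^ 2 ∧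
    d = p₂ * p₃ + q₂ * q₃ + r₂ * r₃ ∧ e = p₁ * p₃ + q₁ * q₃ + r₁ * r₃ ∧
    f = p₁ * p₂ + q₁ * q₂ + r₁ * r₂

theorem IsGram.swap12 {a b c d e f : ℤ} (h : IsGram b a c e d f) : IsGram a b c d e f := by
  obtain ⟨p₁, q₁, r₁, p₂, q₂, r₂, p₃, q₃, r₃, h1, h2, h3, h4, h5, h6⟩ := h
  exact ⟨p₂, q₂, r₂, p₁, q₁, r₁, p₃, q₃, r₃, h2, h1, h3, h5, h4, by rw [h6]; ring⟩

theorem IsGram.swap23 {a b c d e f : ℤ} (h : IsGram a c b d f e) : IsGram a b c d e f := by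
  obtain ⟨p₁, q₁, r₁, p₂, q₂, r₂, p₃, q₃, r₃, h1, h2, h3, h4, h5, h6⟩ := h
  exact ⟨p₁, q₁, r₁, p₃, q₃, r₃, p₂, q₂, r₂, h1, h3, h2, by rw [h4]; ring, h6, h5⟩

/-- Undo `e₂ ↦ e₂ + k e₁`. -/
theorem IsGram.shift12 {a b c d e f : ℤ} (k : ℤ)
    (h : IsGram a (b + 2 * k * f + k ^ 2 * a) c (d + k * e) e (f + k * a)) :
    IsGram a b c d e f := by
  obtain ⟨p₁, q₁, r₁, p₂, q₂, r₂, p₃, q₃, r₃, h1, h2, h3, h4, h5, h6⟩ := h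
  refine ⟨p₁, q₁, r₁, p₂ - k * p₁, q₂ - k * q₁, r₂ - k * r₁, p₃, q₃, r₃, h1, ?_, h3, ?_, h5, ?_⟩
  · linear_combination h2 - 2 * k * h6 + k ^ 2 * h1
  · linear_combination h4 - k * h5
  · linear_combination h6 - k * h1

/-- Undo `e₃ ↦ e₃ + k e₂`. -/
theorem IsGram.shift23 {a b c d e f : ℤ} (k : ℤ)
    (h : IsGram a b (c + 2 * k * d + k ^ 2 * b) (d + k * b) (e + k * f) f) :
    IsGram a b c d e f := by
  obtain ⟨p₁, q₁, r₁, p₂, q₂, r₂, p₃, q₃, r₃, h1, h2, h3, h4, h5, h6⟩ := h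
  refine ⟨p₁, q₁, r₁, p₂, q₂, r₂, p₃ - k * p₂, q₃ - k * q₂, r₃ - k * r₂, h1, h2, ?_, ?_, ?_, h6⟩
  · linear_combination h3 - 2 * k * h4 + k ^ 2 * h2
  · linear_combination h4 - k * h2
  · linear_combination h5 - k * h6

/-- Base case: `a = 1` and `ab - f² = 1`. -/
theorem isGram_base {b c d e f : ℤ} (hA : b - f ^ 2 = 1)
    (hdet : b * c + 2 * d * e * f - d ^ 2 - b * e ^ 2 - c * f ^ 2 = 1) :
    IsGram 1 b c d e f := by
  refine ⟨1, 0, 0, f, 1, 0, e, d - e * f, 1, by ring, by linarith, ?_, by ring, by ring, by ring⟩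
  have hb : b = 1 + f ^ 2 := by linarith
  subst hb
  linear_combination hdet

theorem isGram_of_det_one (N : ℕ) : ∀ (M : ℕ) (a b c d e f : ℤ), a = N → a * b - f ^ 2 = M →
    0 < a → 0 < a * b - f ^ 2 →
    a * b * c + 2 * d * e * f - a * d ^ 2 - b * e ^ 2 - c * f ^ 2 = 1 →
    IsGram a b c d e f := by
  induction N using Nat.strong_induction_on with
  | _ N ihN =>
  intro M
  induction M using Nat.strong_induction_on with
  | _ M ihM =>
  intro a b c d e f haN hM ha hA hdet
  -- first shift
  obtain ⟨k, hk1, hk2⟩ := exists_shift a f ha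
  apply IsGram.shift12 k
  have hA' : a * (b + 2 * k * f + k ^ 2 * a) - (f + k * a) ^ 2 = a * b - f ^ 2 := by ring
  have hdet' : a * (b + 2 * k * f + k ^ 2 * a) * c + 2 * (d + k * e) * e * (f + k * a)
    - a * (d + k * e) ^ 2 - (b + 2 * k * f + k ^ 2 * a) * e ^ 2 - c * (f + k * a) ^ 2 = 1 := by
    rw [← hdet]; ring
  rw [← hA'] at hM hA
  generalize b + 2 * k * f + k ^ 2 * a = b at *
  generalize f + k * a = f at *
  generalize d + k * e = d at *
  clear hdet hA'
  have hb : 0 < b := by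
    by_contra hb
    push Not at hb
    nlinarith [sq_nonneg f]
  by_cases hba : b < a
  · apply IsGram.swap12
    refine ihN b.toNat (by omega) (b * a - f ^ 2).toNat b a c e d f (by omega) ?_ hb ?_ ?_
    · rw [Int.toNat_of_nonneg]; nlinarith
    · linarith [mul_comm a b]
    · linear_combination hdet'
  push Not at hba
  have hf : 4 * f ^ 2 ≤ a ^ 2 := by nlinarith
  have hineq1 : 3 * a ^ 2 ≤ 4 * (a * b - f ^ 2) := by nlinarith
  -- second shift
  obtain ⟨l, hl1, hl2⟩ := exists_shift (a * b - f ^ 2) (a * d - e * f) hA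
  apply IsGram.shift23 l
  have hdet2 : a * b * (c + 2 * l * d + l ^ 2 * b) + 2 * (d + l * b) * (e + l * f) * f
    - a * (d + l * b) ^ 2 - b * (e + l * f) ^ 2 - (c + 2 * l * d + l ^ 2 * b) * f ^ 2 = 1 := by
    rw [← hdet']; ring
  have hB : a * d - e * f + l * (a * b - f ^ 2) = a * (d + l * b) - (e + l * f) * f := by ring
  rw [hB] at hl1 hl2
  generalize c + 2 * l * d + l ^ 2 * b = c at *
  generalize d + l * b = d at *
  generalize e + l * f = e at *
  clear hB hdet' hk1 hk2
  have hprod : (a * b - f ^ 2) * (a * c - e ^ 2) = a + (a * d - e * f) ^ 2 := by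
    linear_combination a * hdet2
  have hC : 0 < a * c - e ^ 2 := by
    by_contra hC
    push Not at hC
    nlinarith [sq_nonneg (a * d - e * f)]
  by_cases hlt : a * c - e ^ 2 < a * b - f ^ 2
  · apply IsGram.swap23
    refine ihM (a * c - e ^ 2).toNat (by omega) a c b d f e haN (by omega) ha hC ?_
    linear_combination hdet2
  push Not at hlt
  generalize hAA : a * b - f ^ 2 = A at *
  generalize a * c - e ^ 2 = C at *
  generalize a * d - e * f = B at *
  have hB2 : 4 * B ^ 2 ≤ A ^ 2 := by nlinarith
  have hineq2 : 3 * A ^ 2 ≤ 4 * a := by nlinarith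
  have ha1 : a = 1 := by
    by_contra h
    have h2 : 2 ≤ a := by omega
    have h3 : 3 * a ≤ 2 * A := by nlinarith
    nlinarith
  subst ha1
  have hA1 : A = 1 := by nlinarith
  apply isGram_base
  · linarith
  · linear_combination hdet2

/-- If `-D` is a square modulo `m D - 1`, then `m` is a sum of three squares. -/
theorem three_sq_of_sq (m D x a : ℤ) (hD : 0 < D) (hb : 0 < m * D - 1)
    (h : a * (m * D - 1) = D + x ^ 2) : ∃ p q r : ℤ, m = p ^ 2 + q ^ 2 + r ^ 2 := by
  have ha : 0 < a := by
    by_contra hc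
    push Not at hc
    nlinarith [sq_nonneg x]
  have hA : a * (m * D - 1) - x ^ 2 = D := by linarith
  have := isGram_of_det_one a.toNat D.toNat a (m * D - 1) m 0 1 x (by omega) (by omega) ha
    (by omega) (by linear_combination m * hA)
  obtain ⟨_, _, _, _, _, _, p, q, r, _, _, h, _⟩ := this
  exact ⟨p, q, r, h⟩

open scoped NumberTheorySymbols in
theorem exists_sq_mod (p D : ℕ) (hp : p.Prime) (hp4 : p % 4 = 1) (h : J(D | p) = 1) :
    ∃ x : ℤ, (p : ℤ) ∣ D + x ^ 2 := by
  have := Fact.mk hp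
  have h1 : J(-(D : ℤ) | p) = 1 := by
    rw [jacobiSym.neg _ (Nat.odd_iff.2 (by omega)), ZMod.χ₄_nat_one_mod_four hp4, h, one_mul]
  obtain ⟨y, hy⟩ := ZMod.isSquare_of_jacobiSym_eq_one h1
  refine ⟨(y.val : ℤ), ?_⟩
  rw [← ZMod.intCast_zmod_eq_zero_iff_dvd]
  push_cast at hy ⊢
  rw [ZMod.natCast_zmod_val, sq, ← hy]
  ring

open scoped NumberTheorySymbols in
theorem three_sq_two_mod_four (m : ℕ) (hm : m % 4 = 2) :
    ∃ p q r : ℤ, (m : ℤ) = p ^ 2 + q ^ 2 + r ^ 2 := by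
  have hcop : (m - 1).Coprime (4 * m) := by
    apply Nat.Coprime.mul_right
    · have : Nat.Coprime (m - 1) (2 ^ 2) :=
        Nat.Coprime.pow_right 2 (Nat.coprime_two_right.2 (Nat.odd_iff.2 (by omega)))
      simpa using this
    · have := Nat.coprime_self_add_right (m := m - 1) (n := 1)
      rw [show m - 1 + 1 = m by omega] at this
      rw [this]; simp
  obtain ⟨p, hpm, hp, hmod⟩ := Nat.forall_exists_prime_gt_and_modEq m (by omega) hcop
  obtain ⟨t, ht⟩ := (Nat.modEq_iff_dvd' (by omega : m - 1 ≤ p)).1 hmod.symm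
  have hpD : p + 1 = m * (4 * t + 1) := by
    have : p = 4 * m * t + (m - 1) := by omega
    have h2 : 4 * m * t + (m - 1) + 1 = 4 * m * t + m := by omega
    rw [this, h2]; ring
  have hp4 : p % 4 = 1 := by
    have : p = 4 * (m * t) + (m - 1) := by rw [← mul_assoc]; omega
    omega
  have hJ : J((4 * t + 1 : ℕ) | p) = 1 := by
    rw [jacobiSym.quadratic_reciprocity_one_mod_four (by omega) (Nat.odd_iff.2 (by omega))]
    have : J((p : ℤ) | 4 * t + 1) = J(-1 | 4 * t + 1) := by
      apply jacobiSym.mod_left'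
      apply Int.emod_emod_of_dvd _ (dvd_refl _) |>.symm.trans
      rw [Int.emod_emod]
      apply Int.emod_eq_emod_iff_emod_sub_eq_zero.2
      apply Int.emod_eq_zero_of_dvd
      refine ⟨m, ?_⟩
      have : (p : ℤ) + 1 = m * ((4 * t + 1 : ℕ) : ℤ) := by exact_mod_cast hpD
      linear_combination this
    rw [this, jacobiSym.at_neg_one (Nat.odd_iff.2 (by omega)),
      ZMod.χ₄_nat_one_mod_four (by omega)]
  obtain ⟨x, a, hx⟩ := exists_sq_mod p _ hp hp4 hJ
  have hpD' : (p : ℤ) = m * ((4 * t + 1 : ℕ) : ℤ) - 1 := by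
    have : (p : ℤ) + 1 = m * ((4 * t + 1 : ℕ) : ℤ) := by exact_mod_cast hpD
    linarith
  refine three_sq_of_sq m ((4 * t + 1 : ℕ) : ℤ) x a (by positivity) ?_ ?_
  · rw [← hpD']; exact_mod_cast hp.pos
  · rw [← hpD', hx]; ring

open scoped NumberTheorySymbols in
theorem three_sq_one_mod_eight (m : ℕ) (hm : m % 8 = 1) :
    ∃ p q r : ℤ, (m : ℤ) = p ^ 2 + q ^ 2 + r ^ 2 := by
  obtain ⟨s, hs⟩ : ∃ s, 2 * s + 1 = 3 * m := ⟨(3 * m - 1) / 2, by omega⟩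
  have hcop : s.Coprime (4 * m) := by
    apply Nat.Coprime.mul_right
    · have : Nat.Coprime s (2 ^ 2) :=
        Nat.Coprime.pow_right 2 (Nat.coprime_two_right.2 (Nat.odd_iff.2 (by omega)))
      simpa using this
    · rw [← Nat.isCoprime_iff_coprime]
      refine ⟨-2, 3, ?_⟩
      have : (2 * s + 1 : ℤ) = 3 * m := by exact_mod_cast hs
      linarith
  obtain ⟨p, hpm, hp, hmod⟩ := Nat.forall_exists_prime_gt_and_modEq (2 * m) (by omega) hcop
  obtain ⟨t, ht⟩ := (Nat.modEq_iff_dvd' (by omega : s ≤ p)).1 hmod.symm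
  have hpt : p = 4 * (m * t) + s := by rw [← mul_assoc]; omega
  have hpD : 2 * p + 1 = m * (8 * t + 3) := by
    rw [hpt]; linarith
  have hp4 : p % 4 = 1 := by omega
  have hJ : J((8 * t + 3 : ℕ) | p) = 1 := by
    rw [jacobiSym.quadratic_reciprocity_one_mod_four' (Nat.odd_iff.2 (by omega)) hp4]
    have h1 : J(2 * (p : ℤ) | 8 * t + 3) = J(-1 | 8 * t + 3) := by
      apply jacobiSym.mod_left'
      apply Int.emod_eq_emod_iff_emod_sub_eq_zero.2
      apply Int.emod_eq_zero_of_dvd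
      refine ⟨m, ?_⟩
      have : 2 * (p : ℤ) + 1 = m * ((8 * t + 3 : ℕ) : ℤ) := by exact_mod_cast hpD
      linear_combination this
    rw [jacobiSym.mul_left, jacobiSym.at_neg_one (Nat.odd_iff.2 (by omega)),
      ZMod.χ₄_nat_three_mod_four (by omega), jacobiSym.at_two (Nat.odd_iff.2 (by omega)),
      ZMod.χ₈_nat_eq_if_mod_eight] at h1
    rw [if_neg (by omega), if_neg (by omega)] at h1
    linarith
  obtain ⟨x₀, hx₀⟩ := exists_sq_mod p _ hp hp4 hJ
  obtain ⟨x, hx, hxo⟩ : ∃ x : ℤ, (p : ℤ) ∣ (8 * t + 3 : ℕ) + x ^ 2 ∧ x % 2 = 1 := by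
    rcases Int.emod_two_eq_zero_or_one x₀ with h | h
    · refine ⟨x₀ + p, ?_, by omega⟩
      obtain ⟨y, hy⟩ := hx₀
      exact ⟨y + 2 * x₀ + p, by linear_combination hy⟩
    · exact ⟨x₀, hx₀, h⟩
  obtain ⟨y, hy⟩ := hx
  have hy2 : y % 2 = 0 := by
    have h1 : (((8 * t + 3 : ℕ) : ℤ) + x ^ 2) % 2 = 0 := by
      obtain ⟨z, rfl⟩ : ∃ z, x = 2 * z + 1 := ⟨x / 2, by omega⟩
      apply Int.emod_eq_zero_of_dvd
      exact ⟨4 * t + 2 + 2 * z ^ 2 + 2 * z, by push_cast; ring⟩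
    rw [hy, Int.mul_emod, show (p : ℤ) % 2 = 1 by omega] at h1
    omega
  obtain ⟨a, rfl⟩ : ∃ a, y = 2 * a := ⟨y / 2, by omega⟩
  have hpD' : 2 * (p : ℤ) = m * ((8 * t + 3 : ℕ) : ℤ) - 1 := by
    have : 2 * (p : ℤ) + 1 = m * ((8 * t + 3 : ℕ) : ℤ) := by exact_mod_cast hpD
    linarith
  refine three_sq_of_sq m ((8 * t + 3 : ℕ) : ℤ) x a (by positivity) ?_ ?_
  · rw [← hpD']; have := hp.pos; positivity
  · rw [← hpD', hy]; ring

/-- A sum of three squares that is not `1 mod 3` is of the form `2r² + 3d² + 6q²`. -/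
theorem form236 (m A B C : ℤ) (h : m = A ^ 2 + B ^ 2 + C ^ 2) (hm : m % 3 ≠ 1) :
    ∃ r d q : ℤ, m = 2 * r ^ 2 + 3 * d ^ 2 + 6 * q ^ 2 := by
  -- parity: arrange that two have equal parity
  wlog hAB : A % 2 = B % 2 generalizing A B C
  · rcases (by omega : A % 2 = C % 2 ∨ B % 2 = C % 2) with h' | h'
    · exact this A C B (by rw [h]; ring) h'
    · exact this B C A (by rw [h]; ring) h'
  have key : ∀ A B C : ℤ, m = A ^ 2 + B ^ 2 + C ^ 2 → A % 2 = B % 2 → (A + B + C) % 3 = 0 →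
      ∃ r d q : ℤ, m = 2 * r ^ 2 + 3 * d ^ 2 + 6 * q ^ 2 := by
    intro A B C h h2 h3
    obtain ⟨d, hd⟩ : ∃ d, A + B + C = 3 * d := ⟨(A + B + C) / 3, by omega⟩
    obtain ⟨r, hr⟩ : ∃ r, A = B + 2 * r := ⟨(A - B) / 2, by omega⟩
    refine ⟨r, d, B + r - d, ?_⟩
    have : C = 3 * d - A - B := by linarith
    rw [h, this, hr]; ring
  have sq3 : ∀ X : ℤ, (X % 3 = 0 ∧ X ^ 2 % 3 = 0) ∨ (X % 3 = 1 ∧ X ^ 2 % 3 = 1) ∨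
      (X % 3 = 2 ∧ X ^ 2 % 3 = 1) := by
    intro X
    have : X % 3 = 0 ∨ X % 3 = 1 ∨ X % 3 = 2 := by omega
    rcases this with h | h | h <;> simp [pow_two, Int.mul_emod, h]
  have hA := sq3 A
  have hB := sq3 B
  have hC := sq3 C
  have : (A + B + C) % 3 = 0 ∨ (A + B + -C) % 3 = 0 ∨ (A + -B + C) % 3 = 0 ∨
      (-A + B + C) % 3 = 0 := by omega
  rcases this with h' | h' | h' | h'
  · exact key A B C h hAB h'
  · exact key A B (-C) (by rw [h]; ring) hAB h'
  · exact key A (-B) C (by rw [h]; ring) (by omega) h'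
  · exact key (-A) B C (by rw [h]; ring) (by omega) h'

theorem cauchy_lemma (a b : ℤ) (hab : a % 2 = b % 2)
    (h3 : ∃ A B C : ℤ, 6 * a - b ^ 2 = A ^ 2 + B ^ 2 + C ^ 2) :
    ∃ u x y z : ℤ, a = u ^ 2 + x ^ 2 + 2 * y ^ 2 + 2 * z ^ 2 ∧ b = u + x + 2 * y + 2 * z := by
  obtain ⟨A, B, C, h⟩ := h3
  have hb3 : (b % 3 = 0 ∧ b ^ 2 % 3 = 0) ∨ (b % 3 = 1 ∧ b ^ 2 % 3 = 1) ∨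
      (b % 3 = 2 ∧ b ^ 2 % 3 = 1) := by
    have : b % 3 = 0 ∨ b % 3 = 1 ∨ b % 3 = 2 := by omega
    rcases this with h | h | h <;> simp [pow_two, Int.mul_emod, h]
  obtain ⟨r₀, d, q, hm⟩ := form236 _ A B C h (by omega)
  obtain ⟨r, hr, hrb⟩ : ∃ r : ℤ, 6 * a - b ^ 2 = 2 * r ^ 2 + 3 * d ^ 2 + 6 * q ^ 2 ∧
      (b - r) % 3 = 0 := by
    have hr3 : (r₀ % 3 = 0 ∧ r₀ ^ 2 % 3 = 0) ∨ (r₀ % 3 = 1 ∧ r₀ ^ 2 % 3 = 1) ∨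
      (r₀ % 3 = 2 ∧ r₀ ^ 2 % 3 = 1) := by
      have : r₀ % 3 = 0 ∨ r₀ % 3 = 1 ∨ r₀ % 3 = 2 := by omega
      rcases this with h | h | h <;> simp [pow_two, Int.mul_emod, h]
    rcases (by omega : (b - r₀) % 3 = 0 ∨ (b - -r₀) % 3 = 0) with h' | h'
    · exact ⟨r₀, hm, h'⟩
    · exact ⟨-r₀, by rw [hm]; ring, h'⟩
  obtain ⟨p, hp⟩ : ∃ p, b - r = 3 * p := ⟨(b - r) / 3, by omega⟩
  -- squares modulo 8
  have sq4 : ∀ X : ℤ, (X % 2 = 0 ∧ X ^ 2 % 4 = 0) ∨ (X % 2 = 1 ∧ X ^ 2 % 8 = 1) := by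
    intro X
    have : X % 8 = 0 ∨ X % 8 = 1 ∨ X % 8 = 2 ∨ X % 8 = 3 ∨ X % 8 = 4 ∨ X % 8 = 5 ∨ X % 8 = 6 ∨
      X % 8 = 7 := by omega
    have h8 : X ^ 2 % 8 = (X % 8) * (X % 8) % 8 := by rw [pow_two, Int.mul_emod]
    rcases this with h | h | h | h | h | h | h | h <;> rw [h] at h8 <;> omega
  have s1 := sq4 b
  have s2 := sq4 r
  have s3 := sq4 d
  have s4 := sq4 q
  have hdb : d % 2 = b % 2 := by omega
  have hqp : q % 2 = p % 2 := by omega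
  obtain ⟨y, hy⟩ : ∃ y, p + q = 2 * y := ⟨(p + q) / 2, by omega⟩
  obtain ⟨u, hu⟩ : ∃ u, b - 2 * p + d = 2 * u := ⟨(b - 2 * p + d) / 2, by omega⟩
  refine ⟨u, b - 2 * p - u, y, p - y, ?_, by ring⟩
  have e1 : q = 2 * y - p := by linarith
  have e2 : d = 2 * u - b + 2 * p := by linarith
  have e3 : r = b - 3 * p := by linarith
  rw [e1, e2, e3] at hr
  nlinarith

theorem hex_cast (x : ℕ) : ((x * (2 * x - 1) : ℕ) : ℤ) = 2 * (x : ℤ) ^ 2 - x := by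
  rcases Nat.eq_zero_or_pos x with rfl | h
  · simp
  · rw [Nat.cast_mul, Nat.cast_sub (by omega)]; push_cast; ring

theorem tri_exists (u : ℤ) : ∃ w : ℕ, ((w * (w + 1) / 2 : ℕ) : ℤ) = 2 * u ^ 2 - u := by
  have key : ∀ w : ℕ, ∀ v : ℤ, (w : ℤ) * (w + 1) = 2 * v → ((w * (w + 1) / 2 : ℕ) : ℤ) = v := by
    intro w v h
    have : ((w * (w + 1) : ℕ) : ℤ) = 2 * v := by push_cast; exact h
    omega
  by_cases hu : 0 < u
  · refine ⟨(2 * u - 1).toNat, key _ _ ?_⟩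
    rw [Int.toNat_of_nonneg (by omega)]; ring
  · refine ⟨(-2 * u).toNat, key _ _ ?_⟩
    rw [Int.toNat_of_nonneg (by omega)]; ring

theorem finish (n : ℕ) (a b : ℤ) (hn : (n : ℤ) = 2 * a - b) (hb : 0 ≤ b) (hb4 : 4 * a ≤ b ^ 2)
    (hab : a % 2 = b % 2) (h3 : ∃ A B C : ℤ, 6 * a - b ^ 2 = A ^ 2 + B ^ 2 + C ^ 2) :
    ∃ w x y z : ℕ, n = w * (w + 1) / 2 + x * (2 * x - 1)
          + 2 * (y * (2 * y - 1)) + 2 * (z * (2 * z - 1)) := by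
  obtain ⟨u, x, y, z, h1, h2⟩ := cauchy_lemma a b hab h3
  have hy : 0 ≤ y := by
    by_contra hy
    push Not at hy
    have : b < u + x + 2 * z := by omega
    have h5 : b ^ 2 < (u + x + 2 * z) ^ 2 := by nlinarith
    nlinarith [sq_nonneg (u - x), sq_nonneg (u - z), sq_nonneg (x - z), sq_nonneg y]
  have hz : 0 ≤ z := by
    by_contra hz
    push Not at hz
    have : b < u + x + 2 * y := by omega
    have h5 : b ^ 2 < (u + x + 2 * y) ^ 2 := by nlinarith
    nlinarith [sq_nonneg (u - x), sq_nonneg (u - y), sq_nonneg (x - y), sq_nonneg z]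
  have main : ∀ u x : ℤ, 0 ≤ x → a = u ^ 2 + x ^ 2 + 2 * y ^ 2 + 2 * z ^ 2 →
      b = u + x + 2 * y + 2 * z → ∃ w x y z : ℕ, n = w * (w + 1) / 2 + x * (2 * x - 1)
          + 2 * (y * (2 * y - 1)) + 2 * (z * (2 * z - 1)) := by
    intro u x hx h1 h2
    obtain ⟨w, hw⟩ := tri_exists u
    lift x to ℕ using hx
    lift y to ℕ using hy
    lift z to ℕ using hz
    refine ⟨w, x, y, z, ?_⟩
    have hx := hex_cast x
    have hy := hex_cast y
    have hz := hex_cast z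
    zify
    push_cast at hw hx hy hz ⊢
    rw [hw, hx, hy, hz, hn, h1, h2]
    ring
  by_cases hx : 0 ≤ x
  · exact main u x hx h1 h2
  by_cases hu : 0 ≤ u
  · exact main x u hu (by rw [h1]; ring) (by rw [h2]; ring)
  exfalso
  have : b < 2 * y + 2 * z := by omega
  have h5 : b ^ 2 < (2 * y + 2 * z) ^ 2 := by nlinarith
  nlinarith [sq_nonneg u, sq_nonneg x, sq_nonneg (y - z)]

theorem residue_choice : ∀ n < 16, ∀ s < 16, ∃ r < 16,
    (n % 2 = 0 ∧ (n + s + r) % 4 = 0 ∧ (3 * n + 3 * (s + r) + 15 * ((s + r) * (s + r))) % 16 = 8) ∨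
    (n % 2 = 1 ∧ (n + s + r) % 4 = 2 ∧ (3 * n + 3 * (s + r) + 15 * ((s + r) * (s + r))) % 8 = 1) := by
  decide +kernel

theorem large_case (n : ℕ) (hn : 2600 ≤ n) : ∃ w x y z : ℕ,
      n = w * (w + 1) / 2 + x * (2 * x - 1)
          + 2 * (y * (2 * y - 1)) + 2 * (z * (2 * z - 1)) := by
  obtain ⟨t, ht1, ht2⟩ : ∃ t : ℕ, t * t ≤ 2 * n + 1 ∧ 2 * n + 1 < (t + 1) * (t + 1) :=
    ⟨Nat.sqrt (2 * n + 1), Nat.sqrt_le _, Nat.lt_succ_sqrt _⟩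
  obtain ⟨r, hr, hcase⟩ := residue_choice (n % 16) (Nat.mod_lt _ (by norm_num)) ((t + 2) % 16)
    (Nat.mod_lt _ (by norm_num))
  obtain ⟨b, hb⟩ : ∃ b, b = t + 2 + r := ⟨_, rfl⟩
  have hlow : 2 * n + 2 * b ≤ b * b := by nlinarith
  have hhigh : b * b < 3 * n + 3 * b := by
    have h1 : b ≤ t + 17 := by omega
    have h2 : 31 * t + 239 < n := by
      by_contra hc
      push Not at hc
      nlinarith
    nlinarith
  obtain ⟨m, hm⟩ : ∃ m, 3 * n + 3 * b = b * b + m := ⟨3 * n + 3 * b - b * b, by omega⟩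
  have hmm : (3 * n + 3 * b + 15 * (b * b)) % 16 = m % 16 := by omega
  have hred : (3 * (n % 16) + 3 * ((t + 2) % 16 + r) +
      15 * (((t + 2) % 16 + r) * ((t + 2) % 16 + r))) % 16 = m % 16 := by
    rw [← hmm, hb]
    have e1 : (n % 16) ≡ n [MOD 16] := Nat.mod_modEq _ _
    have e2 : ((t + 2) % 16 + r) ≡ t + 2 + r [MOD 16] := (Nat.mod_modEq _ _).add_right _
    exact ((e1.mul_left 3).add (e2.mul_left 3)).add ((e2.mul e2).mul_left 15)
  generalize 15 * (((t + 2) % 16 + r) * ((t + 2) % 16 + r)) = Q at *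
  obtain ⟨a, ha⟩ : ∃ a, n + b = 2 * a := ⟨(n + b) / 2, by omega⟩
  have hmZ : 6 * (a : ℤ) - (b : ℤ) ^ 2 = m := by
    have h1 : (3 * n + 3 * b : ℤ) = b * b + m := by exact_mod_cast hm
    have h2 : (n + b : ℤ) = 2 * a := by exact_mod_cast ha
    linear_combination h1 - 3 * h2
  refine finish n a b (by omega) (by omega) ?_ (by omega) ?_
  · have h1 : (2 * n + 2 * b : ℤ) ≤ b * b := by exact_mod_cast hlow
    have h2 : (n + b : ℤ) = 2 * a := by exact_mod_cast ha
    nlinarith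
  · rw [hmZ]
    rcases hcase with ⟨h1, h2, h3⟩ | ⟨h1, h2, h3⟩
    · obtain ⟨k, hk⟩ : ∃ k, m = 4 * k := ⟨m / 4, by omega⟩
      obtain ⟨A, B, C, h⟩ := three_sq_two_mod_four k (by omega)
      refine ⟨2 * A, 2 * B, 2 * C, ?_⟩
      rw [hk]; push_cast; rw [h]; ring
    · exact three_sq_one_mod_eight m (by omega)

theorem sum_triangular_hex_1122 (n : ℕ) :
    ∃ w x y z : ℕ,
      n = w * (w + 1) / 2 + x * (2 * x - 1)
          + 2 * (y * (2 * y - 1)) + 2 * (z * (2 * z - 1)) := by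
  rcases Nat.lt_or_ge n 2600 with h | h
  · exact small_case n h
  · exact large_case n h
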